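/- Let n ∈ ℕ and S ⊂ M_d(ℂ) bounded with ε := max_{k ≤ nd} Λ(S^k)^{1/k} ≤ 1. Let Q be the set of linear combinations α₁q₁+⋯+αₘqₘ with qⱼ ∈ S ∪ S² ∪ ⋯ ∪ Sⁿ and Σ|αⱼ| = 1 (the complex convex hull). Then Λ(Q) ≤ 2dε, i.e., every element of Q has spectral radius at most 2dε. -/

import Mathlib

open scoped Pointwise
open Filter

/-- A norm on `ℂ^d`, given as a plain function with the norm axioms. -/
def IsCNorm {d : ℕ} (v : (Fin d → ℂ) → ℝ) : Prop :=
  (∀ x, 0 ≤ v x) ∧ (∀ x, v x = 0 ↔ x = 0) ∧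
  (∀ (a : ℂ) (x), v (a • x) = ‖a‖ * v x) ∧ (∀ x y, v (x + y) ≤ v x + v y)

/-- Operator norm on matrices induced by the norm `v` on `ℂ^d`. -/
noncomputable def opNorm {d : ℕ} (v : (Fin d → ℂ) → ℝ) (A : Matrix (Fin d) (Fin d) ℂ) : ℝ :=
  sSup {c : ℝ | ∃ x : Fin d → ℂ, v x ≤ 1 ∧ c = v (A.mulVec x)}

/-- Norm of a set of matrices: `sup_{s ∈ S} ‖s‖`. -/
noncomputable def setOpNorm {d : ℕ} (v : (Fin d → ℂ) → ℝ)
    (S : Set (Matrix (Fin d) (Fin d) ℂ)) : ℝ :=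
  sSup (opNorm v '' S)

/-- The sup norm on `ℂ^d`, used as reference norm to define the joint spectral radius. -/
noncomputable def stdNorm {d : ℕ} (x : Fin d → ℂ) : ℝ := ‖x‖

/-- The joint spectral radius `ρ(S) = inf_{n ≥ 1} ‖Sⁿ‖^{1/n}`. -/
noncomputable def jsr {d : ℕ} (S : Set (Matrix (Fin d) (Fin d) ℂ)) : ℝ :=
  ⨅ n : ℕ, setOpNorm stdNorm (S ^ (n + 1)) ^ (1 / (n + 1 : ℝ))

/-- The spectral radius of a matrix: the largest modulus of an eigenvalue. -/
noncomputable def specRad {d : ℕ} (A : Matrix (Fin d) (Fin d) ℂ) : ℝ :=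
  sSup ((fun μ : ℂ => ‖μ‖) '' spectrum ℂ A)

/-- `Λ(S) = sup_{s ∈ S} Λ(s)`. -/
noncomputable def lamSet {d : ℕ} (S : Set (Matrix (Fin d) (Fin d) ℂ)) : ℝ :=
  sSup (specRad '' S)

/-- Boundedness of a set of matrices. -/
def MatBdd {d : ℕ} (S : Set (Matrix (Fin d) (Fin d) ℂ)) : Prop :=
  ∃ C : ℝ, ∀ A ∈ S, ∀ i j, ‖A i j‖ ≤ C

/-- `S` is irreducible: it preserves no nonzero proper subspace of `ℂ^d`. -/
def IsIrred {d : ℕ} (S : Set (Matrix (Fin d) (Fin d) ℂ)) : Prop :=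
  ∀ W : Submodule ℂ (Fin d → ℂ), (∀ A ∈ S, ∀ x ∈ W, A.mulVec x ∈ W) → W = ⊥ ∨ W = ⊤

/-- The complex convex hull of a set of matrices: linear combinations `Σ αⱼqⱼ` with
`qⱼ ∈ Q` and `Σ|αⱼ| = 1`. -/
def cConvHull {d : ℕ} (Q : Set (Matrix (Fin d) (Fin d) ℂ)) : Set (Matrix (Fin d) (Fin d) ℂ) :=
  {a | ∃ (m : ℕ) (α : Fin m → ℂ) (q : Fin m → Matrix (Fin d) (Fin d) ℂ),
    (∀ j, q j ∈ Q) ∧ (∑ j, ‖α j‖) = 1 ∧ a = ∑ j, α j • q j}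


open Polynomial in
theorem aux_roots {d : ℕ} (A : Matrix (Fin d) (Fin d) ℂ) :
    ∃ f : Fin d → ℂ, A.charpoly = ∏ i, (X - C (f i)) := by
  have hs : A.charpoly.Splits := IsAlgClosed.splits _
  have h := hs.eq_prod_roots_of_monic A.charpoly_monic
  have hc : Multiset.card A.charpoly.roots = d := by
    rw [← hs.natDegree_eq_card_roots, Matrix.charpoly_natDegree_eq_dim, Fintype.card_fin]
  obtain ⟨l, hl⟩ := Quot.exists_rep A.charpoly.roots
  have hl' : (l : Multiset ℂ) = A.charpoly.roots := hl
  rw [← hl'] at h hc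
  have hc' : l.length = d := by simpa using hc
  subst hc'
  refine ⟨fun i => l.get i, ?_⟩
  rw [h, Multiset.map_coe, Multiset.prod_coe]
  rw [← List.prod_ofFn]
  congr 1
  apply List.ext_get <;> simp

open Polynomial in
theorem aux_det {d : ℕ} (A : Matrix (Fin d) (Fin d) ℂ) (f : Fin d → ℂ)
    (hf : A.charpoly = ∏ i, (X - C (f i))) (p : ℂ[X]) :
    (aeval A p).det = ∏ i, p.eval (f i) := by
  have h1 : ∀ r : ℂ, (aeval A (X - C r)).det = ∏ i, (X - C r).eval (f i) := by
    intro r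
    have h := Matrix.eval_charpoly A r
    rw [hf, eval_prod] at h
    have h2 : aeval A (X - C r) = -(Matrix.scalar (Fin d) r - A) := by
      simp [Algebra.algebraMap_eq_smul_one, Matrix.smul_one_eq_diagonal]
    rw [h2, Matrix.det_neg, ← h]
    have h3 : ∀ i, (X - C r).eval (f i) = (-1) * eval r (X - C (f i)) := by
      intro i; simp
    simp_rw [h3]
    rw [Finset.prod_mul_distrib]
    simp
  have hm : ∀ m : Multiset ℂ, (aeval A (m.map (X - C ·)).prod).det
      = ∏ i, ((m.map (X - C ·)).prod).eval (f i) := by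
    intro m
    induction m using Multiset.induction_on with
    | empty => simp
    | cons r m ih =>
      simp only [Multiset.map_cons, Multiset.prod_cons, map_mul, Matrix.det_mul, eval_mul,
        Finset.prod_mul_distrib] at *
      rw [h1 r, ih]
  have hp := (IsAlgClosed.splits p).eq_prod_roots
  rw [hp]
  simp only [map_mul, Matrix.det_mul, eval_mul, Finset.prod_mul_distrib]
  rw [hm]
  congr 1
  simp [Algebra.algebraMap_eq_smul_one]

open Polynomial in
theorem aux_charpoly_pow {d : ℕ} (A : Matrix (Fin d) (Fin d) ℂ) (f : Fin d → ℂ)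
    (hf : A.charpoly = ∏ i, (X - C (f i))) (k : ℕ) :
    (A ^ k).charpoly = ∏ i, (X - C (f i ^ k)) := by
  apply Polynomial.funext
  intro x
  have h := aux_det A f hf (C x - X ^ k)
  rw [Matrix.eval_charpoly, eval_prod]
  simp only [eval_sub, eval_C, eval_pow, eval_X] at h ⊢
  rw [← h]
  simp [Algebra.algebraMap_eq_smul_one, Matrix.smul_one_eq_diagonal]

open Polynomial in
theorem aux_trace_pow {d : ℕ} (A : Matrix (Fin d) (Fin d) ℂ) (f : Fin d → ℂ)
    (hf : A.charpoly = ∏ i, (X - C (f i))) (k : ℕ) :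
    (A ^ k).trace = ∑ i, f i ^ k := by
  rw [Matrix.trace_eq_sum_roots_charpoly, aux_charpoly_pow A f hf k]
  have := Polynomial.roots_multiset_prod_X_sub_C (Finset.univ.val.map fun i => f i ^ k)
  rw [Multiset.map_map] at this
  have h2 : (∏ i, (X - C (f i ^ k))).roots = Finset.univ.val.map fun i => f i ^ k := this
  rw [h2]
  rfl

theorem aux_newton {d : ℕ} (f : Fin d → ℂ) (δ : ℝ)
    (hp : ∀ k, 1 ≤ k → k ≤ d → ‖∑ i, f i ^ k‖ ≤ δ ^ k) (k : ℕ) (hk : k ≤ d) :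
    ‖(Finset.univ.val.map f).esymm k‖ ≤ δ ^ k := by
  induction k using Nat.strong_induction_on with
  | _ k ih =>
  rcases Nat.eq_zero_or_pos k with rfl | hk0
  · simp [Multiset.esymm]
  have h := congrArg (MvPolynomial.aeval f) (MvPolynomial.mul_esymm_eq_sum (Fin d) ℂ k)
  simp only [map_mul, map_natCast, map_sum, map_pow, map_neg, map_one,
    MvPolynomial.aeval_esymm_eq_multiset_esymm, MvPolynomial.psum, MvPolynomial.aeval_X] at h
  have h2 := congrArg norm h
  rw [norm_mul, norm_mul, norm_pow, norm_neg, norm_one, one_pow, one_mul, Complex.norm_natCast] at h2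
  have h3 : (k : ℝ) * ‖(Finset.univ.val.map f).esymm k‖ ≤ k * δ ^ k := by
    rw [h2]
    refine (norm_sum_le _ _).trans ?_
    have hc : ((Finset.HasAntidiagonal.antidiagonal k).filter (fun a => a.1 < k)).card = k := by
      rw [Finset.Nat.antidiagonal_eq_map, Finset.filter_map, Finset.card_map]
      have : (Finset.range (k + 1)).filter (fun a => a < k) = Finset.range k := by
        ext; simp; omega
      refine Eq.trans ?_ (Finset.card_range k)
      rw [← this]
      rfl
    calc _ ≤ ∑ a ∈ (Finset.HasAntidiagonal.antidiagonal k).filter (fun a => a.1 < k), δ ^ k := by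
          apply Finset.sum_le_sum
          intro a ha
          simp only [Finset.mem_filter, Finset.HasAntidiagonal.mem_antidiagonal] at ha
          obtain ⟨ha1, ha2⟩ := ha
          rw [norm_mul, norm_mul, norm_pow, norm_neg, norm_one, one_pow, one_mul, ← ha1, pow_add]
          exact mul_le_mul (ih a.1 ha2 (by omega)) (hp a.2 (by omega) (by omega))
            (norm_nonneg _) ((norm_nonneg _).trans (ih a.1 ha2 (by omega)))
      _ = k * δ ^ k := by rw [Finset.sum_const, hc, nsmul_eq_mul]
  exact le_of_mul_le_mul_left h3 (by exact_mod_cast hk0)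

theorem aux_geom (δ x : ℝ) (hδ : 0 ≤ δ) (hx : 2 * δ < x) (d : ℕ) :
    ∑ j ∈ Finset.range d, δ ^ (j + 1) * x ^ (d - (j + 1)) < x ^ d := by
  have hx0 : 0 < x := by linarith
  induction d with
  | zero => simp
  | succ d ih =>
    rw [Finset.sum_range_succ']
    have : ∑ j ∈ Finset.range d, δ ^ (j + 1 + 1) * x ^ (d + 1 - (j + 1 + 1))
        = δ * ∑ j ∈ Finset.range d, δ ^ (j + 1) * x ^ (d - (j + 1)) := by
      rw [Finset.mul_sum]
      apply Finset.sum_congr rfl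
      intro j _
      rw [Nat.add_sub_add_right]; ring
    rw [this]
    have h1 := mul_le_mul_of_nonneg_left ih.le hδ
    have h2 := mul_lt_mul_of_pos_right hx (pow_pos hx0 d)
    simp only [zero_add, pow_one, Nat.add_sub_cancel]
    rw [pow_succ]
    nlinarith

open Polynomial in
theorem aux_trace_lemma {d : ℕ} (A : Matrix (Fin d) (Fin d) ℂ) (δ : ℝ) (hδ : 0 ≤ δ)
    (h : ∀ k, 1 ≤ k → k ≤ d → ‖(A ^ k).trace‖ ≤ δ ^ k) : specRad A ≤ 2 * δ := by
  obtain ⟨f, hf⟩ := aux_roots A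
  simp only [aux_trace_pow A f hf] at h
  have he := aux_newton f δ h
  apply Real.sSup_le _ (by linarith)
  rintro _ ⟨μ, hμ, rfl⟩
  rw [Matrix.mem_spectrum_iff_isRoot_charpoly, hf] at hμ
  by_contra! hlt
  have h1 := Multiset.prod_X_sub_X_eq_sum_esymm (Finset.univ.val.map f)
  rw [Multiset.map_map] at h1
  have h2 : ∏ i, (X - C (f i)) = (Multiset.map ((fun t => X - C t) ∘ f) Finset.univ.val).prod := rfl
  rw [h2, h1, IsRoot, eval_finsetSum] at hμ
  simp only [Multiset.card_map, Finset.card_val, Finset.card_univ, Fintype.card_fin] at hμ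
  rw [Finset.sum_range_succ'] at hμ
  simp only [eval_mul, eval_pow, eval_neg, eval_one, eval_C, eval_X] at hμ
  have h3 : (Finset.univ.val.map f).esymm 0 = 1 := by simp [Multiset.esymm]
  rw [h3] at hμ
  simp only [pow_zero, one_mul, Nat.sub_zero] at hμ
  have h4 := congrArg norm (eq_neg_of_add_eq_zero_right hμ)
  rw [norm_neg, norm_pow] at h4
  have h5 := aux_geom δ ‖μ‖ hδ hlt d
  have h6 := norm_sum_le (Finset.range d) fun j =>
    (-1 : ℂ) ^ (j + 1) * ((Finset.univ.val.map f).esymm (j + 1) * μ ^ (d - (j + 1)))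
  have h7 : ∑ j ∈ Finset.range d,
      ‖(-1 : ℂ) ^ (j + 1) * ((Finset.univ.val.map f).esymm (j + 1) * μ ^ (d - (j + 1)))‖
      ≤ ∑ j ∈ Finset.range d, δ ^ (j + 1) * ‖μ‖ ^ (d - (j + 1)) := by
    apply Finset.sum_le_sum
    intro j hj
    rw [norm_mul, norm_mul, norm_pow, norm_pow, norm_neg, norm_one, one_pow, one_mul]
    exact mul_le_mul_of_nonneg_right (he _ (by simpa using hj)) (by positivity)
  linarith

section
attribute [local instance] Matrix.linftyOpNormedRing Matrix.linftyOpNormedAlgebra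

theorem aux_spec_bdd {d : ℕ} (A : Matrix (Fin d) (Fin d) ℂ) :
    ∀ μ ∈ spectrum ℂ A, ‖μ‖ ≤ ‖A‖ * ‖(1 : Matrix (Fin d) (Fin d) ℂ)‖ := fun _ h =>
  spectrum.norm_le_norm_mul_of_mem h

theorem aux_le_specRad {d : ℕ} (A : Matrix (Fin d) (Fin d) ℂ) (μ : ℂ) (h : μ ∈ spectrum ℂ A) :
    ‖μ‖ ≤ specRad A := by
  have hb : BddAbove ((fun μ : ℂ => ‖μ‖) '' spectrum ℂ A) := by
    refine ⟨‖A‖ * ‖(1 : Matrix (Fin d) (Fin d) ℂ)‖, ?_⟩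
    rintro _ ⟨μ, h, rfl⟩
    exact aux_spec_bdd A μ h
  exact le_csSup hb ⟨μ, h, rfl⟩

theorem aux_bdd {d : ℕ} (S : Set (Matrix (Fin d) (Fin d) ℂ)) (hS : MatBdd S) (k : ℕ) :
    BddAbove (specRad '' (S ^ k)) := by
  obtain ⟨C, hC⟩ := hS
  have h1 : ∀ A ∈ S, ‖A‖ ≤ d * |C| := by
    intro A hA
    rw [← coe_nnnorm, Matrix.linfty_opNNNorm_def]
    have : (Finset.univ.sup fun i => ∑ j, ‖A i j‖₊) ≤ d * ‖C‖₊ := by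
      apply Finset.sup_le
      intro i _
      calc ∑ j, ‖A i j‖₊ ≤ ∑ j : Fin d, ‖C‖₊ := by
            apply Finset.sum_le_sum
            intro j _
            have := (hC A hA i j).trans (le_abs_self C)
            exact this
        _ = _ := by simp
    exact_mod_cast this
  have h2 : ∃ B : ℝ, ∀ A ∈ S ^ k, ‖A‖ ≤ B := by
    induction k with
    | zero => exact ⟨‖(1 : Matrix (Fin d) (Fin d) ℂ)‖, by simp⟩
    | succ k ih =>
      obtain ⟨B, hB⟩ := ih
      refine ⟨B * (d * |C|), ?_⟩
      rw [pow_succ]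
      rintro _ ⟨x, hx, y, hy, rfl⟩
      exact (norm_mul_le x y).trans (mul_le_mul (hB x hx) (h1 y hy) (norm_nonneg _)
        ((norm_nonneg _).trans (hB x hx)))
  obtain ⟨B, hB⟩ := h2
  refine ⟨|B| * ‖(1 : Matrix (Fin d) (Fin d) ℂ)‖, ?_⟩
  rintro _ ⟨A, hA, rfl⟩
  apply Real.sSup_le _ (by positivity)
  rintro _ ⟨μ, h, rfl⟩
  exact (aux_spec_bdd A μ h).trans
    (mul_le_mul_of_nonneg_right ((hB A hA).trans (le_abs_self B)) (norm_nonneg _))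

end

theorem aux_trace_le {d : ℕ} (A : Matrix (Fin d) (Fin d) ℂ) : ‖A.trace‖ ≤ d * specRad A := by
  obtain ⟨f, hf⟩ := aux_roots A
  have h := aux_trace_pow A f hf 1
  simp only [pow_one] at h
  rw [h]
  refine (norm_sum_le _ _).trans ?_
  calc ∑ i, ‖f i‖ ≤ ∑ i : Fin d, specRad A := by
        apply Finset.sum_le_sum
        intro i _
        apply aux_le_specRad
        rw [Matrix.mem_spectrum_iff_isRoot_charpoly, hf, Polynomial.IsRoot, Polynomial.eval_prod]
        exact Finset.prod_eq_zero (Finset.mem_univ i) (by simp)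
    _ = _ := by simp

theorem aux_hull {d : ℕ} (U : Set (Matrix (Fin d) (Fin d) ℂ)) (a : Matrix (Fin d) (Fin d) ℂ)
    (ha : a ∈ cConvHull U) (M : ℝ) (k : ℕ) :
    ∀ L : Matrix (Fin d) (Fin d) ℂ →ₗ[ℂ] ℂ, (∀ w ∈ U ^ k, ‖L w‖ ≤ M) → ‖L (a ^ k)‖ ≤ M := by
  obtain ⟨m, α, q, hq, hα, rfl⟩ := ha
  induction k with
  | zero => intro L h; exact h _ (by simp)
  | succ k ih =>
    intro L h
    have hj : ∀ j, ‖L ((∑ j, α j • q j) ^ k * q j)‖ ≤ M := by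
      intro j
      apply ih (L ∘ₗ LinearMap.mulRight ℂ (q j))
      intro w hw
      apply h
      rw [pow_succ]
      exact Set.mul_mem_mul hw (hq j)
    rw [pow_succ, Finset.mul_sum, map_sum]
    refine (norm_sum_le _ _).trans ?_
    calc _ ≤ ∑ j, ‖α j‖ * M := by
          apply Finset.sum_le_sum
          intro j _
          rw [mul_smul_comm, map_smul, smul_eq_mul, norm_mul]
          exact mul_le_mul_of_nonneg_left (hj j) (norm_nonneg _)
      _ = M := by rw [← Finset.sum_mul, hα, one_mul]

theorem aux_mem {d : ℕ} (n : ℕ) (S : Set (Matrix (Fin d) (Fin d) ℂ)) (k : ℕ) :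
    ∀ w ∈ (⋃ k ∈ Finset.Icc 1 n, S ^ k) ^ k, ∃ j, k ≤ j ∧ j ≤ n * k ∧ w ∈ S ^ j := by
  induction k with
  | zero => intro w hw; exact ⟨0, le_rfl, by simp, by simpa using hw⟩
  | succ k ih =>
    intro w hw
    rw [pow_succ] at hw
    obtain ⟨x, hx, y, hy, rfl⟩ := hw
    obtain ⟨j, h1, h2, h3⟩ := ih x hx
    simp only [Set.mem_iUnion, Finset.mem_Icc] at hy
    obtain ⟨i, ⟨hi1, hi2⟩, hy⟩ := hy
    refine ⟨j + i, by omega, by rw [Nat.mul_succ]; omega, ?_⟩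
    rw [pow_add]
    exact Set.mul_mem_mul h3 hy

/-- if `ε` bounds `Λ(S^k)^{1/k}` for all `k ≤ nd` and `ε ≤ 1`, then every
element of the complex convex hull `Q` of `S ∪ S² ∪ ⋯ ∪ Sⁿ` has spectral radius
at most `2dε`. -/
theorem stmt_15 {d : ℕ} (n : ℕ) (S : Set (Matrix (Fin d) (Fin d) ℂ)) (hS : MatBdd S)
    (ε : ℝ) (hε0 : 0 ≤ ε) (hε1 : ε ≤ 1)
    (hε : ∀ k : ℕ, 1 ≤ k → k ≤ n * d → lamSet (S ^ k) ≤ ε ^ k) :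
    ∀ a ∈ cConvHull (⋃ k ∈ Finset.Icc 1 n, S ^ k), specRad a ≤ 2 * d * ε := by
  intro a ha
  rw [mul_assoc]
  apply aux_trace_lemma a _ (by positivity)
  intro k hk1 hkd
  have h := aux_hull _ a ha (d * ε ^ k) k (Matrix.traceLinearMap (Fin d) ℂ ℂ) ?_
  · refine le_trans h ?_
    rw [mul_pow]
    apply mul_le_mul_of_nonneg_right _ (by positivity)
    have hd : (1 : ℝ) ≤ d := by exact_mod_cast hk1.trans hkd
    exact le_self_pow₀ hd (by omega)
  · intro w hw
    obtain ⟨j, h1, h2, h3⟩ := aux_mem n S k w hw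
    have h4 : specRad w ≤ ε ^ j :=
      (le_csSup (aux_bdd S hS j) ⟨w, h3, rfl⟩).trans
        (hε j (by omega) (h2.trans (Nat.mul_le_mul_left n hkd)))
    have h5 : ε ^ j ≤ ε ^ k := pow_le_pow_of_le_one hε0 hε1 h1
    exact (aux_trace_le w).trans (mul_le_mul_of_nonneg_left (h4.trans h5) (by positivity))
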